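/- For two agents whose true valuations are unary additive (over any number m of goods), Priority-E-C-E always has a pure Nash equilibrium whose induced allocation is EF1 with respect to the true valuations. -/

import Mathlib

/-!
Formalization of the strategic Envy-Cycle-Elimination (E-C-E) setting.

There are `n` agents and `m` goods (`Fin m`), with the predefined ordering of agents
and goods given by the orders on `Fin n` and `Fin m`.  A bid consists of a reported
additive valuation (a nonnegative value for every good) together with a preference
list (a permutation of the goods).  E-C-E starts from empty bundles and, while
unallocated goods remain, selects a source of the envy graph (according to the rule of
the respective variant), adds one unallocated good to that agent's bundle (again
according to the rule of the respective variant), and then repeatedly eliminates envy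
cycles, in a fixed order, until the envy graph has a source.
-/

open scoped Classical
open Finset

/-- A bid of an agent: a reported additive valuation (a nonnegative value for every
good) together with a preference list, a permutation of the goods. -/
structure Bid (m : ℕ) where
  val : Fin m → ℝ
  nonneg : ∀ g, 0 ≤ val g
  pref : Equiv.Perm (Fin m)

namespace ECE

variable {n m : ℕ}

/-- Reported (additive) value of a bundle. -/
noncomputable def bval (b : Bid m) (S : Finset (Fin m)) : ℝ := ∑ g ∈ S, b.val g

/-- (True, additive) value of a bundle under the valuation `v`. -/
noncomputable def value (v : Fin m → ℝ) (S : Finset (Fin m)) : ℝ := ∑ g ∈ S, v g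

/-- Envy-graph edge: agent `i` envies agent `j` (w.r.t. the reported valuations) under
the partial allocation `P`. -/
def envies (b : Fin n → Bid m) (P : Fin n → Finset (Fin m)) (i j : Fin n) : Prop :=
  bval (b i) (P i) < bval (b i) (P j)

/-- The sources (vertices of in-degree 0) of the envy graph. -/
noncomputable def sources (b : Fin n → Bid m) (P : Fin n → Finset (Fin m)) :
    Finset (Fin n) :=
  univ.filter fun i => ∀ j, ¬ envies b P j i

/-- The envy cycles of the current envy graph, represented as cyclic permutations `σ`
of the agents such that every agent moved by `σ` envies her image under `σ`. -/
noncomputable def cycleSet (b : Fin n → Bid m) (P : Fin n → Finset (Fin m)) :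
    Finset (Equiv.Perm (Fin n)) :=
  univ.filter fun σ => σ.IsCycle ∧ ∀ i, σ i ≠ i → envies b P i (σ i)

/-- A fixed enumeration of the permutations of the agents, providing the fixed
(lexicographic) order in which envy cycles are eliminated. -/
noncomputable def permIdx (n : ℕ) :
    Equiv.Perm (Fin n) ≃ Fin (Fintype.card (Equiv.Perm (Fin n))) :=
  Fintype.equivFin _

/-- Eliminate one envy cycle (the first one in the fixed order): every agent on the
cycle receives the bundle of the agent she envies. -/
noncomputable def elimOnce (b : Fin n → Bid m) (P : Fin n → Finset (Fin m)) :
    Fin n → Finset (Fin m) :=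
  if h : (cycleSet b P).Nonempty then
    let σ := (permIdx n).symm (((cycleSet b P).image (permIdx n)).min' (h.image _))
    fun i => P (σ i)
  else P

/-- Repeatedly eliminate envy cycles until the envy graph has a source. -/
noncomputable def resolve (b : Fin n → Bid m) :
    ℕ → (Fin n → Finset (Fin m)) → Fin n → Finset (Fin m)
  | 0, P => P
  | fuel + 1, P => if (sources b P).Nonempty then P else resolve b fuel (elimOnce b P)

/-- The state (current partial allocation, remaining unallocated goods) of an E-C-E
run after a given number of steps.  In each step, if unallocated goods remain, the
agent chosen by `pickAgent` (a source of the envy graph) receives the good chosen by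
`pickItem`, and afterwards envy cycles are eliminated until the graph has a source. -/
noncomputable def stateECE (b : Fin n → Bid m)
    (pickAgent : (Fin n → Finset (Fin m)) → Option (Fin n))
    (pickItem : Fin n → (R : Finset (Fin m)) → R.Nonempty → Fin m) :
    ℕ → (Fin n → Finset (Fin m)) × Finset (Fin m)
  | 0 => (fun _ => ∅, univ)
  | k + 1 =>
    let s := stateECE b pickAgent pickItem k
    if hR : s.2.Nonempty then
      match pickAgent s.1 with
      | none => s
      | some i =>
        let g := pickItem i s.2 hR
        (resolve b (n * n + 1) (fun j => if j = i then insert g (s.1 j) else s.1 j),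
          s.2.erase g)
    else s

/-- Source selection of Standard-E-C-E: among multiple sources, the agent earliest in
the predefined ordering of the agents. -/
noncomputable def stdAgent (b : Fin n → Bid m) (P : Fin n → Finset (Fin m)) :
    Option (Fin n) :=
  if h : (sources b P).Nonempty then some ((sources b P).min' h) else none

/-- Source selection of the Priority variants: among multiple sources, those having at
least one outgoing envy edge have priority, ties broken by the predefined ordering of
the agents. -/
noncomputable def priAgent (b : Fin n → Bid m) (P : Fin n → Finset (Fin m)) :
    Option (Fin n) :=
  if h' : ((sources b P).filter fun i => ∃ j, envies b P i j).Nonempty then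
    some (((sources b P).filter fun i => ∃ j, envies b P i j).min' h')
  else if h : (sources b P).Nonempty then some ((sources b P).min' h) else none

/-- The unallocated good of highest reported value, ties broken by the predefined
ordering of the goods. -/
noncomputable def bestItem (v : Fin m → ℝ) (R : Finset (Fin m)) (hR : R.Nonempty) :
    Fin m :=
  (R.filter fun g => ∀ g' ∈ R, v g' ≤ v g).min' (by
    obtain ⟨g, hg, hmax⟩ := R.exists_max_image v hR
    exact ⟨g, mem_filter.2 ⟨hg, hmax⟩⟩)

/-- The earliest unallocated good in the preference list `pref`. -/
noncomputable def preferredItem (pref : Equiv.Perm (Fin m)) (R : Finset (Fin m))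
    (hR : R.Nonempty) : Fin m :=
  pref.symm ((R.image pref).min' (hR.image _))

/-- Standard-E-C-E: sources chosen by the predefined agent ordering, goods assigned in
the predefined ordering of the goods. -/
noncomputable def Standard (b : Fin n → Bid m) : Fin n → Finset (Fin m) :=
  (stateECE b (stdAgent b) (fun _ R hR => R.min' hR) m).1

/-- Priority-E-C-E: envious sources have priority (ties broken by the agent ordering),
goods assigned in the predefined ordering of the goods. -/
noncomputable def Priority (b : Fin n → Bid m) : Fin n → Finset (Fin m) :=
  (stateECE b (priAgent b) (fun _ R hR => R.min' hR) m).1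

/-- Best-Item-E-C-E: envious sources have priority, and the chosen agent receives her
unallocated good of highest reported value (ties broken by the good ordering). -/
noncomputable def BestItemECE (b : Fin n → Bid m) : Fin n → Finset (Fin m) :=
  (stateECE b (priAgent b) (fun i R hR => bestItem (b i).val R hR) m).1

/-- Preferred-Item-E-C-E: envious sources have priority, and the chosen agent receives
the earliest unallocated good in her preference list. -/
noncomputable def PreferredItemECE (b : Fin n → Bid m) : Fin n → Finset (Fin m) :=
  (stateECE b (priAgent b) (fun i R hR => preferredItem (b i).pref R hR) m).1

/-- The allocation `A` is `α`-EF1 from agent `i`'s perspective w.r.t. the valuation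
`v`: for every agent `j` with nonempty bundle there is a good `g ∈ A j` with
`v (A i) ≥ α · v (A j \ {g})`. -/
def EF1From (α : ℝ) (v : Fin m → ℝ) (A : Fin n → Finset (Fin m)) (i : Fin n) : Prop :=
  ∀ j : Fin n, (A j).Nonempty → ∃ g ∈ A j, α * value v ((A j).erase g) ≤ value v (A i)

/-- The allocation `A` is EF1 w.r.t. the valuations `v`. -/
def IsEF1 (v : Fin n → Fin m → ℝ) (A : Fin n → Finset (Fin m)) : Prop :=
  ∀ i : Fin n, EF1From 1 (v i) A i

/-- Agent `i`'s bid in the profile `b` is a best response to the others' bids, w.r.t.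
her true (additive) valuation `v`: no alternative bid gives her a bundle of strictly
larger true value. -/
def BestResponse (Mech : (Fin n → Bid m) → Fin n → Finset (Fin m))
    (v : Fin m → ℝ) (b : Fin n → Bid m) (i : Fin n) : Prop :=
  ∀ b' : Bid m, value v (Mech (Function.update b i b') i) ≤ value v (Mech b i)

/-- The bid profile `b` is a pure Nash equilibrium of the mechanism `Mech` w.r.t. the
true (additive) valuations `v`. -/
def IsPNE (Mech : (Fin n → Bid m) → Fin n → Finset (Fin m))
    (v : Fin n → Fin m → ℝ) (b : Fin n → Bid m) : Prop :=
  ∀ i : Fin n, BestResponse Mech (v i) b i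

end ECE

namespace ECE

variable {m : ℕ}

lemma not_envies_self {n : ℕ} (b : Fin n → Bid m) (P : Fin n → Finset (Fin m)) (i : Fin n) :
    ¬ envies b P i i := lt_irrefl _

lemma zero_mem_sources_iff (b : Fin 2 → Bid m) (P : Fin 2 → Finset (Fin m)) :
    (0 : Fin 2) ∈ sources b P ↔ ¬ envies b P 1 0 := by
  simp [sources, Fin.forall_fin_two, not_envies_self]

lemma one_mem_sources_iff (b : Fin 2 → Bid m) (P : Fin 2 → Finset (Fin m)) :
    (1 : Fin 2) ∈ sources b P ↔ ¬ envies b P 0 1 := by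
  simp [sources, Fin.forall_fin_two, not_envies_self]

lemma sources_nonempty_iff (b : Fin 2 → Bid m) (P : Fin 2 → Finset (Fin m)) :
    (sources b P).Nonempty ↔ ¬ (envies b P 0 1 ∧ envies b P 1 0) := by
  simp only [Finset.Nonempty, Fin.exists_fin_two, zero_mem_sources_iff, one_mem_sources_iff]
  tauto

/-- With two agents and no mutual envy, Priority-E-C-E serves agent `1` exactly when she
envies agent `0`. -/
lemma priAgent_two (b : Fin 2 → Bid m) (P : Fin 2 → Finset (Fin m))
    (h : ¬ (envies b P 0 1 ∧ envies b P 1 0)) :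
    priAgent b P = some (if envies b P 1 0 then 1 else 0) := by
  have mem0 : (0 : Fin 2) ∈ ((sources b P).filter fun i => ∃ j, envies b P i j) ↔
      ¬ envies b P 1 0 ∧ envies b P 0 1 := by
    simp [zero_mem_sources_iff, Fin.exists_fin_two, not_envies_self]
  have mem1 : (1 : Fin 2) ∈ ((sources b P).filter fun i => ∃ j, envies b P i j) ↔
      ¬ envies b P 0 1 ∧ envies b P 1 0 := by
    simp [one_mem_sources_iff, Fin.exists_fin_two, not_envies_self]
  have min_zero : ∀ (S : Finset (Fin 2)) (hS : S.Nonempty), 0 ∈ S → S.min' hS = 0 :=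
    fun S hS h0 => le_antisymm (S.min'_le 0 h0) (Fin.zero_le _)
  unfold priAgent
  by_cases h1 : envies b P 1 0
  · have h0 : ¬ envies b P 0 1 := fun h0 => h ⟨h0, h1⟩
    have hS : ((sources b P).filter fun i => ∃ j, envies b P i j) = {1} := by
      ext i
      fin_cases i
      · simpa [h1] using mem0
      · simpa [h1, h0] using mem1
    simp only [hS, singleton_nonempty, dif_pos, min'_singleton, if_pos h1]
  · by_cases h0 : envies b P 0 1
    · have hm := mem0.2 ⟨h1, h0⟩
      have hne : Finset.Nonempty _ := ⟨0, hm⟩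
      rw [dif_pos hne, min_zero _ _ hm, if_neg h1]
    · have hm := (zero_mem_sources_iff b P).2 h1
      have hE : ¬ ((sources b P).filter fun i => ∃ j, envies b P i j).Nonempty := by
        rw [Finset.Nonempty, Fin.exists_fin_two, mem0, mem1]
        tauto
      have hne : Finset.Nonempty _ := ⟨0, hm⟩
      rw [dif_neg hE, dif_pos hne, min_zero _ _ hm, if_neg h1]

lemma elimOnce_two (b : Fin 2 → Bid m) (P : Fin 2 → Finset (Fin m))
    (h : envies b P 0 1 ∧ envies b P 1 0) :
    elimOnce b P = fun i => P (Equiv.swap 0 1 i) := by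
  have hne : (cycleSet b P).Nonempty := by
    refine ⟨Equiv.swap 0 1, ?_⟩
    simp only [cycleSet, mem_filter, mem_univ, true_and, Fin.forall_fin_two]
    refine ⟨Equiv.Perm.isCycle_swap (by decide), ?_⟩
    simpa using h
  have hσ : ∀ σ ∈ cycleSet b P, σ = Equiv.swap 0 1 := by
    intro σ hσ
    have h1 : σ ≠ 1 := (mem_filter.1 hσ).2.1.ne_one
    revert h1
    clear hσ
    revert σ
    decide
  obtain ⟨τ, hτ, hτ'⟩ := mem_image.1 (min'_mem _ (hne.image (permIdx 2)))
  rw [elimOnce, dif_pos hne]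
  simp only [← hτ', Equiv.symm_apply_apply, hσ τ hτ]

lemma resolve_two (b : Fin 2 → Bid m) (k : ℕ) (P : Fin 2 → Finset (Fin m)) :
    resolve b (k + 2) P =
      if envies b P 0 1 ∧ envies b P 1 0 then fun i => P (Equiv.swap 0 1 i) else P := by
  by_cases h : envies b P 0 1 ∧ envies b P 1 0
  · have hs : (sources b fun i => P (Equiv.swap 0 1 i)).Nonempty := by
      rw [sources_nonempty_iff]
      simp only [envies, Equiv.swap_apply_left, Equiv.swap_apply_right] at h ⊢
      exact fun h' => lt_asymm h.1 h'.1
    rw [resolve, if_neg (by rwa [sources_nonempty_iff, not_not]), elimOnce_two b P h,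
      resolve, if_pos hs, if_pos h]
  · rw [resolve, if_pos ((sources_nonempty_iff b P).2 h), if_neg h]

/-- Run invariants for Priority-E-C-E with two agents: `Q` is a property of the pair of
bundles that survives handing the next good to the agent in turn when no mutual envy
arises, and also the subsequent exchange when it does. -/
lemma priority_two_induction (b : Fin 2 → Bid m) (Q : Finset (Fin m) → Finset (Fin m) → Prop)
    (h0 : Q ∅ ∅)
    (hzero : ∀ A B g, (∀ x ∈ A, x < g) → (∀ x ∈ B, x < g) → Q A B →
      bval (b 1) A ≤ bval (b 1) B →
      if bval (b 0) (insert g A) < bval (b 0) B ∧ bval (b 1) B < bval (b 1) (insert g A)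
        then Q B (insert g A) else Q (insert g A) B)
    (hone : ∀ A B g, (∀ x ∈ A, x < g) → (∀ x ∈ B, x < g) → Q A B →
      bval (b 1) B < bval (b 1) A → bval (b 0) B ≤ bval (b 0) A →
      if bval (b 0) A < bval (b 0) (insert g B) ∧ bval (b 1) (insert g B) < bval (b 1) A
        then Q (insert g B) A else Q A (insert g B)) :
    Q (Priority b 0) (Priority b 1) ∧ (Priority b 0).card + (Priority b 1).card = m := by
  suffices H : ∀ k ≤ m, ∃ P R, stateECE b (priAgent b) (fun _ R hR => R.min' hR) k = (P, R) ∧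
      R = univ.filter (fun g : Fin m => k ≤ g.val) ∧ (∀ i, ∀ x ∈ P i, x.val < k) ∧
      Q (P 0) (P 1) ∧ (P 0).card + (P 1).card = k ∧ ¬ (envies b P 0 1 ∧ envies b P 1 0) by
    obtain ⟨P, R, hs, -, -, hQ, hc, -⟩ := H m le_rfl
    rw [Priority, hs]
    exact ⟨hQ, hc⟩
  intro k
  induction k with
  | zero =>
    intro _
    refine ⟨fun _ => ∅, univ, rfl, by simp, by simp, h0, by simp, ?_⟩
    simp [envies]
  | succ k ih =>
    intro hk
    obtain ⟨P, R, hs, hR, hlt, hQ, hc, hm⟩ := ih (by omega)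
    have hgR : (⟨k, hk⟩ : Fin m) ∈ R := by simp [hR]
    have hne : R.Nonempty := ⟨_, hgR⟩
    have hmin : R.min' hne = ⟨k, hk⟩ := by
      refine le_antisymm (min'_le _ _ hgR) (le_min' _ _ _ fun x hx => ?_)
      rw [hR] at hx
      exact (mem_filter.1 hx).2
    set g : Fin m := ⟨k, hk⟩ with hg
    have hltg : ∀ i, ∀ x ∈ P i, x < g := fun i x hx => hlt i x hx
    have hnot : ∀ i, g ∉ P i := fun i hgi => lt_irrefl _ (hltg i g hgi)
    have hstep : stateECE b (priAgent b) (fun _ R hR => R.min' hR) (k + 1) =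
        (resolve b (2 * 2 + 1) (fun j => if j = (if envies b P 1 0 then 1 else 0)
          then insert g (P j) else P j), R.erase g) := by
      rw [stateECE]
      simp only [hs, dif_pos hne, priAgent_two b P hm, hmin]
    refine ⟨_, _, hstep, ?_, ?_⟩
    · ext x
      simp only [hR, mem_erase, mem_filter, mem_univ, true_and, hg, ne_eq, Fin.ext_iff]
      omega
    have hbound : ∀ i, ∀ x ∈ insert g (P i), x.val < k + 1 := by
      intro i x hx
      rcases mem_insert.1 hx with rfl | hx
      · exact Nat.lt_succ_self k
      · exact (hlt i x hx).trans (Nat.lt_succ_self k)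
    have hbound' : ∀ i, ∀ x ∈ P i, x.val < k + 1 :=
      fun i x hx => hbound i x (mem_insert_of_mem hx)
    rw [resolve_two]
    by_cases h1 : envies b P 1 0
    · have hcase := hone _ _ g (hltg 0) (hltg 1) hQ h1 (not_lt.1 fun h => hm ⟨h, h1⟩)
      simp only [h1, if_true]
      split_ifs with h
      · have h' := h
        simp only [envies, if_true, zero_ne_one, if_false] at h'
        rw [if_pos h'] at hcase
        simp only [Fin.forall_fin_two, envies, Equiv.swap_apply_left, Equiv.swap_apply_right,
          if_true, zero_ne_one, if_false, card_insert_of_notMem (hnot _)]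
        exact ⟨⟨hbound 1, hbound' 0⟩, hcase, by omega, fun h'' => lt_asymm h'.1 h''.1⟩
      · have h' := h
        simp only [envies, if_true, zero_ne_one, if_false] at h'
        rw [if_neg h'] at hcase
        simp only [Fin.forall_fin_two, if_true, zero_ne_one, if_false,
          card_insert_of_notMem (hnot _)]
        exact ⟨⟨hbound' 0, hbound 1⟩, hcase, by omega, h⟩
    · have hcase := hzero _ _ g (hltg 0) (hltg 1) hQ (not_lt.1 h1)
      simp only [h1, if_false]
      split_ifs with h
      · have h' := h
        simp only [envies, if_true, one_ne_zero, if_false] at h'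
        rw [if_pos h'] at hcase
        simp only [Fin.forall_fin_two, envies, Equiv.swap_apply_left, Equiv.swap_apply_right,
          if_true, one_ne_zero, if_false, card_insert_of_notMem (hnot _)]
        exact ⟨⟨hbound' 1, hbound 0⟩, hcase, by omega, fun h'' => lt_asymm h'.1 h''.1⟩
      · have h' := h
        simp only [envies, if_true, one_ne_zero, if_false] at h'
        rw [if_neg h'] at hcase
        simp only [Fin.forall_fin_two, if_true, one_ne_zero, if_false,
          card_insert_of_notMem (hnot _)]
        exact ⟨⟨hbound 0, hbound' 1⟩, hcase, by omega, h⟩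

/-- The truthful unary bid. -/
noncomputable def unaryBid (m : ℕ) : Bid m := ⟨fun _ => 1, fun _ => zero_le_one, 1⟩

/-- A nearly unary bid: bundles are compared first by cardinality, and among bundles of
equal cardinality later goods dominate all the earlier ones. -/
noncomputable def lateBid (m : ℕ) : Bid m :=
  ⟨fun g => 2 ^ m + 2 ^ g.val, fun _ => by positivity, 1⟩

lemma bval_unaryBid (S : Finset (Fin m)) : bval (unaryBid m) S = S.card := by
  simp [bval, unaryBid]

lemma bval_lateBid (S : Finset (Fin m)) :
    bval (lateBid m) S = ((2 ^ m * S.card + ∑ g ∈ S, 2 ^ g.val : ℕ) : ℝ) := by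
  simp [bval, lateBid, sum_add_distrib, mul_comm]

lemma sum_two_pow_val_lt {k : ℕ} {S : Finset (Fin m)} (h : ∀ x ∈ S, x.val < k) :
    ∑ g ∈ S, 2 ^ g.val < 2 ^ k := by
  have := Nat.geomSum_lt (m := 2) (n := k) (s := S.map Fin.valEmbedding) le_rfl
    (by simpa using fun x (hx : x ∈ S) => h x hx)
  simpa using this

lemma bval_lateBid_lt_of_card_lt {S T : Finset (Fin m)} (h : S.card < T.card) :
    bval (lateBid m) S < bval (lateBid m) T := by
  rw [bval_lateBid, bval_lateBid, Nat.cast_lt]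
  have hS : ∑ g ∈ S, 2 ^ g.val < 2 ^ m := sum_two_pow_val_lt fun x _ => x.isLt
  have : 2 ^ m * (S.card + 1) ≤ 2 ^ m * T.card := Nat.mul_le_mul_left _ h
  rw [mul_add, mul_one] at this
  omega

lemma bval_lateBid_lt_insert {S T : Finset (Fin m)} {g : Fin m} (hS : ∀ x ∈ S, x < g)
    (hT : ∀ x ∈ T, x < g) (h : S.card = T.card + 1) :
    bval (lateBid m) S < bval (lateBid m) (insert g T) := by
  have hg : g ∉ T := fun hg => lt_irrefl _ (hT g hg)
  rw [bval_lateBid, bval_lateBid, Nat.cast_lt, card_insert_of_notMem hg, sum_insert hg, h]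
  have := sum_two_pow_val_lt (k := g.val) hS
  omega

/-- An agent `1` bidding unary receives at most one good less than agent `0`. -/
lemma priority_card_zero_le (b : Fin 2 → Bid m) (hb : b 1 = unaryBid m) :
    (Priority b 0).card ≤ (Priority b 1).card + 1 ∧
      (Priority b 0).card + (Priority b 1).card = m := by
  refine priority_two_induction b (fun A B => A.card ≤ B.card + 1) (by simp) ?_ ?_ <;>
  simp only [hb, bval_unaryBid, Nat.cast_le, Nat.cast_lt]
  · intro A B g hA _ _ hle
    rw [card_insert_of_notMem fun h => lt_irrefl _ (hA g h)]
    split_ifs <;> omega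
  · intro A B g _ hB hQ hlt _
    rw [card_insert_of_notMem fun h => lt_irrefl _ (hB g h)]
    split_ifs <;> omega

/-- Against `lateBid` of agent `0`, agent `1` never receives more than half of the goods. -/
lemma priority_card_one_le (b : Fin 2 → Bid m) (hb : b 0 = lateBid m) :
    (Priority b 1).card ≤ (Priority b 0).card ∧
      (Priority b 0).card + (Priority b 1).card = m := by
  have key := priority_two_induction b
    (fun A B => B.card ≤ A.card ∧ (A.card = B.card →
      bval (lateBid m) A < bval (lateBid m) B ∨ bval (b 1) A ≤ bval (b 1) B))
    (by simp) ?_ ?_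
  · exact ⟨key.1.1, key.2⟩
  · intro A B g hA _ hQ _
    have hc := card_insert_of_notMem fun h => lt_irrefl _ (hA g h)
    rw [hb, if_neg fun h => lt_asymm h.1 (bval_lateBid_lt_of_card_lt (by omega))]
    exact ⟨by omega, fun h => by omega⟩
  · intro A B g hA hB hQ hlt hle
    have hc := card_insert_of_notMem fun h => lt_irrefl _ (hB g h)
    rw [hb] at hle ⊢
    have hAB : B.card < A.card := by
      refine lt_of_le_of_ne hQ.1 fun h => ?_
      rcases hQ.2 h.symm with h' | h' <;> linarith
    rcases Nat.lt_or_eq_of_le (Nat.succ_le_of_lt hAB) with h | h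
    · rw [if_neg fun h' => lt_asymm h'.1 (bval_lateBid_lt_of_card_lt (by omega))]
      exact ⟨by omega, fun h => by omega⟩
    · have hlate := bval_lateBid_lt_insert hA hB h.symm
      split_ifs with h'
      · exact ⟨by omega, fun _ => Or.inr h'.2.le⟩
      · exact ⟨by omega, fun _ => Or.inl hlate⟩

lemma value_one (S : Finset (Fin m)) : value (fun _ => (1 : ℝ)) S = S.card := by
  simp [value]

end ECE

open ECE

/-- For two agents with unary additive true valuations (over any
number `m` of goods), Priority-E-C-E always has a pure Nash equilibrium whose induced
allocation is EF1 with respect to the true valuations. -/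
theorem priority_two_unary_PNE_exists (m : ℕ) :
    ∃ b : Fin 2 → Bid m,
      IsPNE Priority (fun _ _ => (1 : ℝ)) b ∧
      IsEF1 (fun _ _ => (1 : ℝ)) (Priority b) := by
  refine ⟨![lateBid m, unaryBid m], ?_, ?_⟩
  · have h0 := priority_card_zero_le ![lateBid m, unaryBid m] rfl
    have h1 := priority_card_one_le ![lateBid m, unaryBid m] rfl
    intro i b'
    simp only [value_one, Nat.cast_le]
    fin_cases i
    · have h := priority_card_zero_le (Function.update ![lateBid m, unaryBid m] 0 b') rfl
      simp only [Fin.zero_eta]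
      omega
    · have h := priority_card_one_le (Function.update ![lateBid m, unaryBid m] 1 b') rfl
      simp only [Fin.mk_one]
      omega
  · have h0 := priority_card_zero_le ![lateBid m, unaryBid m] rfl
    have h1 := priority_card_one_le ![lateBid m, unaryBid m] rfl
    intro i j hj
    obtain ⟨g, hg⟩ := hj
    refine ⟨g, hg, ?_⟩
    rw [one_mul, value_one, value_one, Nat.cast_le, card_erase_of_mem hg]
    fin_cases i <;> fin_cases j <;> simp only [Fin.zero_eta, Fin.mk_one] <;> omega
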